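/- arXiv:2306.15802 — 5 statements merged into one kernel-verified Lean document; each statement's English description precedes it below -/
import Mathlib

section
/- Let A be a real n×n matrix and C a real q×n matrix. Then ⋂_{k∈ℕ} ker(C Aᵏ) = ⋂_{k=0}^{n−1} ker(C Aᵏ); i.e., the set of vectors annihilated by C Aᵏ for all natural numbers k coincides with the set of vectors annihilated by C Aᵏ for 0 ≤ k ≤ n−1. -/
open Polynomial in
/-- By Cayley–Hamilton, every power of a square matrix is a linear combination of the powers
with exponent less than its size. -/
theorem Matrix.pow_mem_span_pow_lt_card {R m : Type*} [CommRing R] [Nontrivial R] [Fintype m]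
    [DecidableEq m] (A : Matrix m m R) (k : ℕ) :
    A ^ k ∈ Submodule.span R ((A ^ ·) '' {i : ℕ | i < Fintype.card m}) := by
  rw [A.pow_eq_aeval_mod_charpoly k, aeval_def, eval₂_eq_sum, Polynomial.sum]
  refine Submodule.sum_mem _ fun i hi ↦ ?_
  rw [← Algebra.smul_def]
  refine Submodule.smul_mem _ _ (Submodule.subset_span ⟨i, ?_, rfl⟩)
  have h := (le_degree_of_mem_supp i hi).trans_lt (degree_modByMonic_lt (X ^ k) A.charpoly_monic)
  rw [A.charpoly_degree_eq_dim] at h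
  exact_mod_cast h

theorem stmt_4 (n q : ℕ) (A : Matrix (Fin n) (Fin n) ℝ) (C : Matrix (Fin q) (Fin n) ℝ) :
    (⨅ k : ℕ, LinearMap.ker (Matrix.mulVecLin (C * A ^ k))) =
      ⨅ k ∈ Finset.range n, LinearMap.ker (Matrix.mulVecLin (C * A ^ k)) := by
  ext x
  simp only [Submodule.mem_iInf, LinearMap.mem_ker, Matrix.mulVecLin_apply, Finset.mem_range]
  refine ⟨fun h k _ ↦ h k, fun h k ↦ ?_⟩
  have hk := A.pow_mem_span_pow_lt_card k
  generalize A ^ k = P at hk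
  induction hk using Submodule.span_induction with
  | mem _ hM =>
    obtain ⟨i, hi, rfl⟩ := hM
    exact h i (by simpa using hi)
  | zero => simp
  | add M N _ _ hM hN => rw [Matrix.mul_add, Matrix.add_mulVec, hM, hN, add_zero]
  | smul a M _ hM => rw [Matrix.mul_smul, Matrix.smul_mulVec, hM, smul_zero]
end

section
/- (Lemma 1) Let A be a real n×n matrix and C a real q×n matrix, and let z₀ ∈ ℝⁿ. There exists a differentiable function z : ℝ → ℝⁿ with z(0) = z₀ satisfying z'(t) = A z(t) and C z(t) = 0 for all t ∈ ℝ if and only if z₀ ∈ N(A,C) := ⋂_{k=0}^{n−1} ker(C Aᵏ). -/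
/-- By Cayley–Hamilton, vanishing of `C * A ^ k` at `v` for `k < n` gives vanishing for all `k`. -/
theorem Matrix.mul_pow_mulVec_eq_zero_of_forall_lt {R : Type*} [CommRing R] [Nontrivial R]
    {n : ℕ} {m : Type*} (A : Matrix (Fin n) (Fin n) R) (C : Matrix m (Fin n) R) (v : Fin n → R)
    (h : ∀ k < n, (C * A ^ k).mulVec v = 0) (k : ℕ) : (C * A ^ k).mulVec v = 0 := by
  rw [A.pow_eq_aeval_mod_charpoly k, Polynomial.aeval_eq_sum_range, Matrix.mul_sum,
    Matrix.sum_mulVec]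
  refine Finset.sum_eq_zero fun i _ => ?_
  rw [Matrix.mul_smul, Matrix.smul_mulVec]
  rcases lt_or_ge i n with hi | hi
  · rw [h i hi, smul_zero]
  · rw [Polynomial.coeff_eq_zero_of_degree_lt, zero_smul]
    refine (Polynomial.degree_modByMonic_lt _ A.charpoly_monic).trans_le ?_
    rw [A.charpoly_degree_eq_dim, Fintype.card_fin]
    exact_mod_cast hi

/-- If a solution of `z' = A z` satisfies `C z = 0`, then it satisfies `C A ^ k z = 0`. -/
theorem Matrix.mul_pow_mulVec_eq_zero_of_solution {n m : Type*} [Fintype n] [DecidableEq n]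
    [Fintype m] (A : Matrix n n ℝ) (C : Matrix m n ℝ) {z : ℝ → n → ℝ}
    (hz : ∀ t, HasDerivAt z (A.mulVec (z t)) t) (hC : ∀ t, C.mulVec (z t) = 0) (k : ℕ) (t : ℝ) :
    (C * A ^ k).mulVec (z t) = 0 := by
  induction k generalizing t with
  | zero => simpa using hC t
  | succ k ih =>
    have h := (C * A ^ k).mulVecLin.toContinuousLinearMap.hasFDerivAt.comp_hasDerivAt t (hz t)
    have h0 : HasDerivAt (fun s => (C * A ^ k).mulVec (z s)) 0 t := by
      simpa only [ih] using hasDerivAt_const t (0 : m → ℝ)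
    rw [pow_succ, ← Matrix.mul_assoc, ← Matrix.mulVec_mulVec]
    exact h.unique h0

theorem stmt_7 (n q : ℕ) (A : Matrix (Fin n) (Fin n) ℝ) (C : Matrix (Fin q) (Fin n) ℝ)
    (z₀ : Fin n → ℝ) :
    (∃ z : ℝ → (Fin n → ℝ), z 0 = z₀ ∧ Differentiable ℝ z ∧
        (∀ t : ℝ, deriv z t = A.mulVec (z t)) ∧ (∀ t : ℝ, C.mulVec (z t) = 0)) ↔
      z₀ ∈ ⨅ k ∈ Finset.range n, LinearMap.ker (Matrix.mulVecLin (C * A ^ k)) := by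
  simp only [Submodule.mem_iInf, Finset.mem_range, LinearMap.mem_ker, Matrix.mulVecLin_apply]
  constructor
  · rintro ⟨z, rfl, hd, hz, hC⟩ k -
    exact A.mul_pow_mulVec_eq_zero_of_solution C (fun t => hz t ▸ (hd t).hasDerivAt) hC k 0
  · intro h
    let T : (Fin n → ℝ) →L[ℝ] (Fin n → ℝ) := A.mulVecLin.toContinuousLinearMap
    have hT (k : ℕ) : (T ^ k) z₀ = (A ^ k).mulVec z₀ := by
      induction k with
      | zero => simp
      | succ k ih =>
        rw [pow_succ', pow_succ', ← Matrix.mulVec_mulVec, ← ih]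
        rfl
    have hd (t : ℝ) : HasDerivAt (fun s : ℝ => NormedSpace.exp (s • T) z₀)
        (A.mulVec (NormedSpace.exp (t • T) z₀)) t := by
      have h := (hasDerivAt_exp_smul_const' T t).clm_apply (hasDerivAt_const t z₀)
      rw [map_zero, add_zero] at h
      exact h
    refine ⟨fun s => NormedSpace.exp (s • T) z₀, by simp, fun t => (hd t).differentiableAt,
      fun t => (hd t).deriv, fun t => ?_⟩
    let L : ((Fin n → ℝ) →L[ℝ] (Fin n → ℝ)) →L[ℝ] (Fin q → ℝ) :=
      C.mulVecLin.toContinuousLinearMap ∘L ContinuousLinearMap.apply ℝ (Fin n → ℝ) z₀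
    have hL (k : ℕ) : L (T ^ k) = 0 := by
      change C.mulVec ((T ^ k) z₀) = 0
      rw [hT, Matrix.mulVec_mulVec]
      exact A.mul_pow_mulVec_eq_zero_of_forall_lt C z₀ h k
    have hs := (NormedSpace.exp_series_hasSum_exp' (𝕂 := ℝ) (t • T)).mapL L
    simp only [smul_pow, map_smul, hL, smul_zero] at hs
    exact hs.unique hasSum_zero
end

section
/- (Lemma 2) Let A be a real n×n matrix, C a real q×n matrix, and N(A,C) := ⋂_{k=0}^{n−1} ker(C Aᵏ). Let M be a real n×r matrix whose columns are linearly independent with column space equal to N(A,C), and let Mᴸ be any left inverse of M (Mᴸ M = I_r). If z : ℝ → ℝⁿ is differentiable with z'(t) = A z(t) and C z(t) = 0 for all t ∈ ℝ, then z(t) = M y(t) for all t, where y(t) := Mᴸ z(t), and y is differentiable with y'(t) = (Mᴸ A M) y(t) for all t ∈ ℝ. -/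
open Matrix

theorem HasDerivAt.matrix_mulVec {m n : Type*} [Fintype m] [Fintype n] (B : Matrix m n ℝ)
    {z : ℝ → n → ℝ} {z' : n → ℝ} {t : ℝ} (hz : HasDerivAt z z' t) :
    HasDerivAt (fun s => B.mulVec (z s)) (B.mulVec z') t :=
  B.mulVecLin.toContinuousLinearMap.hasFDerivAt.comp_hasDerivAt t hz

/-- Differentiating the constraint `C z = 0` along `z' = A z` shows that all `C Aᵏ` annihilate `z`. -/
theorem mul_pow_mulVec_eq_zero_of_hasDerivAt {m n : Type*} [Fintype m] [Fintype n] [DecidableEq n]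
    {A : Matrix n n ℝ} {C : Matrix m n ℝ} {z : ℝ → n → ℝ}
    (hz : ∀ t, HasDerivAt z (A.mulVec (z t)) t) (hC : ∀ t, C.mulVec (z t) = 0) (k : ℕ) (t : ℝ) :
    (C * A ^ k).mulVec (z t) = 0 := by
  induction k generalizing t with
  | zero => simpa using hC t
  | succ k ih =>
    have hd := (hz t).matrix_mulVec (C * A ^ k)
    simp only [ih, mulVec_mulVec, Matrix.mul_assoc, ← pow_succ] at hd
    exact hd.unique (hasDerivAt_const t 0)

theorem stmt_10 (n q r : ℕ) (A : Matrix (Fin n) (Fin n) ℝ) (C : Matrix (Fin q) (Fin n) ℝ)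
    (M : Matrix (Fin n) (Fin r) ℝ) (ML : Matrix (Fin r) (Fin n) ℝ)
    (hcols : LinearIndependent ℝ Mᵀ)
    (hrange : LinearMap.range M.mulVecLin =
      ⨅ k ∈ Finset.range n, LinearMap.ker (Matrix.mulVecLin (C * A ^ k)))
    (hML : ML * M = 1)
    (z : ℝ → (Fin n → ℝ))
    (hdiff : Differentiable ℝ z)
    (hode : ∀ t : ℝ, deriv z t = A.mulVec (z t))
    (hC : ∀ t : ℝ, C.mulVec (z t) = 0) :
    (∀ t : ℝ, z t = M.mulVec (ML.mulVec (z t))) ∧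
    Differentiable ℝ (fun t => ML.mulVec (z t)) ∧
    (∀ t : ℝ, deriv (fun t => ML.mulVec (z t)) t =
      (ML * A * M).mulVec (ML.mulVec (z t))) := by
  have hz : ∀ t, HasDerivAt z (A.mulVec (z t)) t := fun t => hode t ▸ (hdiff t).hasDerivAt
  have hrec : ∀ t : ℝ, z t = M.mulVec (ML.mulVec (z t)) := by
    intro t
    have hmem : z t ∈ LinearMap.range M.mulVecLin := by
      rw [hrange]
      simpa only [Submodule.mem_iInf, LinearMap.mem_ker, mulVecLin_apply] using
        fun k _ => mul_pow_mulVec_eq_zero_of_hasDerivAt hz hC k t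
    obtain ⟨y, hy⟩ := hmem
    rw [← hy, mulVecLin_apply, mulVec_mulVec y ML M, hML, one_mulVec]
  have hd := fun t => (hz t).matrix_mulVec ML
  refine ⟨hrec, fun t => (hd t).differentiableAt, fun t => ?_⟩
  rw [(hd t).deriv, ← mulVec_mulVec, ← hrec t, mulVec_mulVec]
end

section
/- Let A be a real n×n matrix, C a real q×n matrix, and M a real n×r matrix with left inverse Mᴸ (Mᴸ M = I_r). Suppose the column space of M is A-invariant (every vector A M x lies in the column space of M) and is contained in ker C (C M = 0). If y : ℝ → ℝʳ is differentiable with y'(t) = (Mᴸ A M) y(t) for all t ∈ ℝ, then z(t) := M y(t) satisfies z'(t) = A z(t) and C z(t) = 0 for all t ∈ ℝ; i.e., z solves the DAE. -/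
/-- If `ML` is a left inverse of `M`, then `M * ML` fixes the column space of `M`. -/
theorem mulVec_mulVec_of_mem_range {R m k : Type*} [CommSemiring R] [Fintype m] [Fintype k]
    [DecidableEq k] {M : Matrix m k R} {ML : Matrix k m R} (hML : ML * M = 1) {v : m → R}
    (hv : v ∈ LinearMap.range M.mulVecLin) : M.mulVec (ML.mulVec v) = v := by
  obtain ⟨x, rfl⟩ := hv
  rw [Matrix.mulVecLin_apply, Matrix.mulVec_mulVec x ML M, hML, Matrix.one_mulVec]

theorem stmt_11 (n q r : ℕ) (A : Matrix (Fin n) (Fin n) ℝ) (C : Matrix (Fin q) (Fin n) ℝ)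
    (M : Matrix (Fin n) (Fin r) ℝ) (ML : Matrix (Fin r) (Fin n) ℝ)
    (hML : ML * M = 1)
    (hinv : ∀ x : Fin r → ℝ, A.mulVec (M.mulVec x) ∈ LinearMap.range M.mulVecLin)
    (hCM : C * M = 0)
    (y : ℝ → (Fin r → ℝ))
    (hdiff : Differentiable ℝ y)
    (hode : ∀ t : ℝ, deriv y t = (ML * A * M).mulVec (y t)) :
    (∀ t : ℝ, deriv (fun t => M.mulVec (y t)) t = A.mulVec (M.mulVec (y t))) ∧
    (∀ t : ℝ, C.mulVec (M.mulVec (y t)) = 0) := by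
  refine ⟨fun t => ?_, fun t => by rw [Matrix.mulVec_mulVec, hCM, Matrix.zero_mulVec]⟩
  have hy : HasDerivAt y ((ML * A * M).mulVec (y t)) t := hode t ▸ (hdiff t).hasDerivAt
  have hz : HasDerivAt (fun t => M.mulVec (y t)) (M.mulVec ((ML * A * M).mulVec (y t))) t :=
    (LinearMap.toContinuousLinearMap M.mulVecLin).hasFDerivAt.comp_hasDerivAt t hy
  rw [hz.deriv, ← Matrix.mulVec_mulVec, ← Matrix.mulVec_mulVec]
  exact mulVec_mulVec_of_mem_range hML (hinv (y t))
end

section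
/- Let ψ : ℝ × ℝ → ℝ be infinitely differentiable, satisfy the heat equation ∂_t ψ(t,x) = ∂²_x ψ(t,x) for all (t,x) ∈ ℝ × ℝ, and satisfy the homogeneous Dirichlet boundary conditions ψ(t,1) = 0 and ψ(t,−1) = 0 for all t ∈ ℝ. Then all implicit boundary conditions hold: for every k ∈ ℕ and every t ∈ ℝ, the even-order spatial derivatives vanish at the boundary, iteratedDeriv (2k) (y ↦ ψ(t,y)) 1 = 0 and iteratedDeriv (2k) (y ↦ ψ(t,y)) (−1) = 0. -/
open scoped ContDiff

section PartialDerivatives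

variable {ψ : ℝ → ℝ → ℝ}

theorem deriv_fst_eq_fderiv (h : Differentiable ℝ (fun p : ℝ × ℝ => ψ p.1 p.2)) (t x : ℝ) :
    deriv (fun s => ψ s x) t = fderiv ℝ (fun p : ℝ × ℝ => ψ p.1 p.2) (t, x) (1, 0) := by
  have h1 : HasDerivAt (fun s : ℝ => (s, x)) (1, 0) t :=
    (hasDerivAt_id t).prodMk (hasDerivAt_const t x)
  exact ((h (t, x)).hasFDerivAt.comp_hasDerivAt t h1).deriv

theorem deriv_snd_eq_fderiv (h : Differentiable ℝ (fun p : ℝ × ℝ => ψ p.1 p.2)) (t x : ℝ) :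
    deriv (fun y => ψ t y) x = fderiv ℝ (fun p : ℝ × ℝ => ψ p.1 p.2) (t, x) (0, 1) := by
  have h1 : HasDerivAt (fun y : ℝ => (t, y)) (0, 1) x :=
    (hasDerivAt_const x t).prodMk (hasDerivAt_id x)
  exact ((h (t, x)).hasFDerivAt.comp_hasDerivAt x h1).deriv

theorem ContDiff.deriv_fst_uncurried (h : ContDiff ℝ ∞ (fun p : ℝ × ℝ => ψ p.1 p.2)) :
    ContDiff ℝ ∞ (fun p : ℝ × ℝ => deriv (fun s => ψ s p.2) p.1) := by
  simp_rw [deriv_fst_eq_fderiv (h.differentiable (by simp))]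
  exact (h.fderiv_right (m := ∞) (by simp)).clm_apply contDiff_const

theorem ContDiff.deriv_snd_uncurried (h : ContDiff ℝ ∞ (fun p : ℝ × ℝ => ψ p.1 p.2)) :
    ContDiff ℝ ∞ (fun p : ℝ × ℝ => deriv (fun y => ψ p.1 y) p.2) := by
  simp_rw [deriv_snd_eq_fderiv (h.differentiable (by simp))]
  exact (h.fderiv_right (m := ∞) (by simp)).clm_apply contDiff_const

/-- Mixed partial derivatives of a smooth function of two real variables commute. -/
theorem deriv_deriv_comm (h : ContDiff ℝ ∞ (fun p : ℝ × ℝ => ψ p.1 p.2)) (t x : ℝ) :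
    deriv (fun s => deriv (fun y => ψ s y) x) t = deriv (fun y => deriv (fun s => ψ s y) t) x := by
  have hd := h.differentiable (by simp)
  have hd2 : Differentiable ℝ (fderiv ℝ (fun p : ℝ × ℝ => ψ p.1 p.2)) :=
    (h.fderiv_right (m := ∞) (by simp)).differentiable (by simp)
  have hsymm : IsSymmSndFDerivAt ℝ (fun p : ℝ × ℝ => ψ p.1 p.2) (t, x) :=
    h.contDiffAt.isSymmSndFDerivAt (by
      simpa using WithTop.coe_le_coe.2 (le_top : (2 : ℕ∞) ≤ ⊤))
  rw [deriv_fst_eq_fderiv (ψ := fun s x => deriv (fun y => ψ s y) x)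
      (h.deriv_snd_uncurried.differentiable (by simp)),
    deriv_snd_eq_fderiv (ψ := fun t y => deriv (fun s => ψ s y) t)
      (h.deriv_fst_uncurried.differentiable (by simp))]
  simp_rw [deriv_fst_eq_fderiv hd, deriv_snd_eq_fderiv hd]
  rw [fderiv_clm_apply (hd2 _) (differentiableAt_const _),
    fderiv_clm_apply (hd2 _) (differentiableAt_const _)]
  simpa using hsymm.eq (1, 0) (0, 1)

end PartialDerivatives

/-- A smooth solution of the heat equation which vanishes on the line `x = b` has vanishing spatial
derivatives of even order there. -/
theorem iteratedDeriv_even_eq_zero_of_heat {b : ℝ} (k : ℕ) {ψ : ℝ → ℝ → ℝ}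
    (h : ContDiff ℝ ∞ (fun p : ℝ × ℝ => ψ p.1 p.2))
    (hheat : ∀ t x, deriv (fun s => ψ s x) t = iteratedDeriv 2 (fun y => ψ t y) x)
    (hb : ∀ t, ψ t b = 0) (t : ℝ) : iteratedDeriv (2 * k) (fun y => ψ t y) b = 0 := by
  induction k generalizing ψ with
  | zero => simpa using hb t
  | succ k ih =>
    have heat' (t x : ℝ) :
        deriv (fun s => ψ s x) t = deriv (fun y => deriv (fun z => ψ t z) y) x := by
      rw [hheat, iteratedDeriv_succ, iteratedDeriv_one]
    rw [show 2 * (k + 1) = 2 * k + 1 + 1 by ring, iteratedDeriv_succ', iteratedDeriv_succ']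
    have heq : deriv (deriv fun y => ψ t y) = fun y => deriv (fun s => ψ s y) t :=
      funext fun y => (heat' t y).symm
    rw [heq]
    refine ih (ψ := fun t y => deriv (fun s => ψ s y) t) h.deriv_fst_uncurried
      (fun t x => ?_) (fun t => by simp [hb])
    rw [iteratedDeriv_succ, iteratedDeriv_one]
    simp_rw [heat' _ x]
    rw [deriv_deriv_comm (ψ := fun s y => deriv (fun z => ψ s z) y) h.deriv_snd_uncurried]
    simp_rw [deriv_deriv_comm h]

theorem stmt_18 (ψ : ℝ → ℝ → ℝ)
    (hsmooth : ContDiff ℝ (⊤ : ℕ∞) (fun p : ℝ × ℝ => ψ p.1 p.2))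
    (hheat : ∀ t x : ℝ, deriv (fun s => ψ s x) t = iteratedDeriv 2 (fun y => ψ t y) x)
    (hbc1 : ∀ t : ℝ, ψ t 1 = 0)
    (hbc2 : ∀ t : ℝ, ψ t (-1) = 0) :
    ∀ (k : ℕ) (t : ℝ),
      iteratedDeriv (2 * k) (fun y => ψ t y) 1 = 0 ∧
      iteratedDeriv (2 * k) (fun y => ψ t y) (-1) = 0 := by
  exact fun k t => ⟨iteratedDeriv_even_eq_zero_of_heat k hsmooth hheat hbc1 t,
    iteratedDeriv_even_eq_zero_of_heat k hsmooth hheat hbc2 t⟩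
end
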